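/- Let P₁, P₂, P₃ be orthogonal projections on a Hilbert space H with pairwise compact differences. Then the relative index is additive: ind(P₃ : Im P₁ → Im P₃) = ind(P₂ : Im P₁ → Im P₂) + ind(P₃ : Im P₂ → Im P₃). -/

import Mathlib

/-- The Fredholm index of a linear map: `dim ker − dim coker`. -/
noncomputable def fredholmIndex {𝕜 V W : Type*} [Field 𝕜] [AddCommGroup V] [Module 𝕜 V]
    [AddCommGroup W] [Module 𝕜 W] (f : V →ₗ[𝕜] W) : ℤ :=
  (Module.finrank 𝕜 (LinearMap.ker f) : ℤ) -
    (Module.finrank 𝕜 (W ⧸ LinearMap.range f) : ℤ)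

/-- `f` has finite-dimensional kernel and cokernel, and Fredholm index `n`. -/
structure HasFredholmIndex {𝕜 V W : Type*} [Field 𝕜] [AddCommGroup V] [Module 𝕜 V]
    [AddCommGroup W] [Module 𝕜 W] (f : V →ₗ[𝕜] W) (n : ℤ) : Prop where
  finite_ker : FiniteDimensional 𝕜 (LinearMap.ker f)
  finite_coker : FiniteDimensional 𝕜 (W ⧸ LinearMap.range f)
  index_eq : fredholmIndex f = n

theorem finiteDimensional_of_ker_of_range {𝕜 V W : Type*} [Field 𝕜] [AddCommGroup V] [Module 𝕜 V]
    [AddCommGroup W] [Module 𝕜 W] (f : V →ₗ[𝕜] W) [FiniteDimensional 𝕜 (LinearMap.ker f)]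
    [FiniteDimensional 𝕜 (LinearMap.range f)] : FiniteDimensional 𝕜 V :=
  .of_exact (f := (LinearMap.ker f).subtype) (g := f.rangeRestrict)
    (LinearMap.exact_iff.2 (by simp)) f.surjective_rangeRestrict

open Module in
/-- Additivity of the Fredholm index under composition, from the exact sequence
`0 → ker f → ker (g ∘ f) → ker g → coker f → coker (g ∘ f) → coker g → 0`. -/
theorem HasFredholmIndex.comp {𝕜 V W X : Type*} [Field 𝕜] [AddCommGroup V] [Module 𝕜 V]
    [AddCommGroup W] [Module 𝕜 W] [AddCommGroup X] [Module 𝕜 X]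
    {g : W →ₗ[𝕜] X} {f : V →ₗ[𝕜] W} {m n : ℤ}
    (hg : HasFredholmIndex g m) (hf : HasFredholmIndex f n) :
    HasFredholmIndex (g ∘ₗ f) (m + n) := by
  obtain ⟨_, _, rfl⟩ := hg
  obtain ⟨_, _, rfl⟩ := hf
  let φ₁ : LinearMap.ker (g ∘ₗ f) →ₗ[𝕜] LinearMap.ker g :=
    (f.domRestrict _).codRestrict _ fun x ↦ x.2
  let φ₂ : LinearMap.ker g →ₗ[𝕜] W ⧸ LinearMap.range f :=
    (LinearMap.range f).mkQ.domRestrict _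
  let φ₃ : (W ⧸ LinearMap.range f) →ₗ[𝕜] X ⧸ LinearMap.range (g ∘ₗ f) :=
    Submodule.mapQ _ _ g (by rintro _ ⟨x, rfl⟩; exact ⟨x, rfl⟩)
  let φ₄ : (X ⧸ LinearMap.range (g ∘ₗ f)) →ₗ[𝕜] X ⧸ LinearMap.range g :=
    Submodule.mapQ _ _ LinearMap.id (by rintro _ ⟨x, rfl⟩; exact ⟨f x, rfl⟩)
  have hle : LinearMap.ker f ≤ LinearMap.ker (g ∘ₗ f) := LinearMap.ker_le_ker_comp f g
  have hk₁ : LinearMap.ker φ₁ = (LinearMap.ker f).submoduleOf (LinearMap.ker (g ∘ₗ f)) := by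
    ext x
    rw [LinearMap.mem_ker, Submodule.submoduleOf, Submodule.mem_comap, LinearMap.mem_ker]
    exact Subtype.ext_iff
  have hk₂ : LinearMap.ker φ₂ = LinearMap.range φ₁ := by
    ext ⟨w, hw⟩
    simp only [φ₂, φ₁, LinearMap.mem_ker, LinearMap.domRestrict_apply, Submodule.mkQ_apply,
      Submodule.Quotient.mk_eq_zero, LinearMap.mem_range]
    constructor
    · rintro ⟨x, rfl⟩
      exact ⟨⟨x, hw⟩, rfl⟩
    · rintro ⟨x, hx⟩
      exact ⟨x, congrArg Subtype.val hx⟩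
  have hk₃ : LinearMap.ker φ₃ = LinearMap.range φ₂ := by
    ext w
    obtain ⟨w, rfl⟩ := Submodule.Quotient.mk_surjective _ w
    simp only [φ₃, φ₂, LinearMap.mem_ker, Submodule.mapQ_apply,
      Submodule.Quotient.mk_eq_zero, LinearMap.mem_range, LinearMap.domRestrict_apply,
      Submodule.mkQ_apply, Submodule.Quotient.eq, LinearMap.comp_apply]
    constructor
    · rintro ⟨x, hx⟩
      exact ⟨⟨w - f x, by simp [hx]⟩, -x, by simp⟩
    · rintro ⟨⟨k, hk⟩, x, hx⟩
      refine ⟨-x, ?_⟩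
      rw [map_neg, hx, map_neg, map_sub, LinearMap.mem_ker.1 hk, zero_sub, neg_neg]
  have hk₄ : LinearMap.ker φ₄ = LinearMap.range φ₃ := by
    ext y
    obtain ⟨y, rfl⟩ := Submodule.Quotient.mk_surjective _ y
    simp only [φ₄, φ₃, LinearMap.mem_ker, Submodule.mapQ_apply,
      Submodule.Quotient.mk_eq_zero, LinearMap.mem_range, LinearMap.id_apply]
    constructor
    · rintro ⟨w, rfl⟩
      exact ⟨Submodule.Quotient.mk w, rfl⟩
    · rintro ⟨w, hw⟩
      obtain ⟨w, rfl⟩ := Submodule.Quotient.mk_surjective _ w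
      rw [Submodule.mapQ_apply, Submodule.Quotient.eq] at hw
      obtain ⟨x, hx⟩ := hw
      refine ⟨w - f x, ?_⟩
      rw [map_sub, ← LinearMap.comp_apply, hx]
      abel
  have hr₄ : LinearMap.range φ₄ = ⊤ := by
    refine LinearMap.range_eq_top.2 fun y ↦ ?_
    obtain ⟨y, rfl⟩ := Submodule.Quotient.mk_surjective _ y
    exact ⟨Submodule.Quotient.mk y, rfl⟩
  have e₁ : LinearMap.ker φ₁ ≃ₗ[𝕜] LinearMap.ker f :=
    (LinearEquiv.ofEq _ _ hk₁).trans (Submodule.submoduleOfEquivOfLe hle)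
  have : FiniteDimensional 𝕜 (LinearMap.ker φ₁) := e₁.symm.finiteDimensional
  have : FiniteDimensional 𝕜 (LinearMap.ker (g ∘ₗ f)) := finiteDimensional_of_ker_of_range φ₁
  have : FiniteDimensional 𝕜 (LinearMap.ker φ₄) := by rw [hk₄]; infer_instance
  have : FiniteDimensional 𝕜 (X ⧸ LinearMap.range (g ∘ₗ f)) := finiteDimensional_of_ker_of_range φ₄
  have d₁ := φ₁.finrank_range_add_finrank_ker
  have d₂ := φ₂.finrank_range_add_finrank_ker
  have d₃ := φ₃.finrank_range_add_finrank_ker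
  have d₄ := φ₄.finrank_range_add_finrank_ker
  rw [e₁.finrank_eq] at d₁
  rw [hk₂] at d₂
  rw [hk₃] at d₃
  rw [hk₄, hr₄, finrank_top] at d₄
  refine ⟨inferInstance, inferInstance, ?_⟩
  unfold fredholmIndex
  lia

open Module in
theorem hasFredholmIndex_id_add_of_finite_range {𝕜 V : Type*} [Field 𝕜] [AddCommGroup V] [Module 𝕜 V]
    (F : V →ₗ[𝕜] V) [FiniteDimensional 𝕜 (LinearMap.range F)] :
    HasFredholmIndex (LinearMap.id + F) 0 := by
  set A := LinearMap.id + F with hA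
  have hAx (x : V) : A x = x + F x := rfl
  let B : LinearMap.range F →ₗ[𝕜] LinearMap.range F :=
    A.restrict fun x hx ↦ add_mem hx ⟨x, rfl⟩
  have hBx (x : LinearMap.range F) : (B x : V) = A x := rfl
  have hker : LinearMap.ker A ≤ LinearMap.range F := fun x hx ↦
    ⟨-x, by rw [map_neg, neg_eq_iff_add_eq_zero, add_comm, ← hAx]; exact hx⟩
  have e : LinearMap.ker B ≃ₗ[𝕜] LinearMap.ker A :=
    (LinearEquiv.ofEq _ ((LinearMap.ker A).submoduleOf (LinearMap.range F)) (by
      ext x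
      simp [Submodule.submoduleOf, Subtype.ext_iff, hBx])).trans
      (Submodule.submoduleOfEquivOfLe hker)
  let q : LinearMap.range F →ₗ[𝕜] V ⧸ LinearMap.range A := (LinearMap.range A).mkQ.domRestrict _
  have hq : LinearMap.range q = ⊤ := by
    refine LinearMap.range_eq_top.2 fun y ↦ ?_
    obtain ⟨y, rfl⟩ := Submodule.Quotient.mk_surjective _ y
    refine ⟨⟨-F y, -y, by simp⟩, ?_⟩
    simp only [q, LinearMap.domRestrict_apply, Submodule.mkQ_apply, Submodule.Quotient.eq]
    exact ⟨-y, by rw [hAx, map_neg]; abel⟩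
  have hkq : LinearMap.ker q = LinearMap.range B := by
    ext ⟨y, hy⟩
    simp only [q, LinearMap.mem_ker, LinearMap.domRestrict_apply, Submodule.mkQ_apply,
      Submodule.Quotient.mk_eq_zero, LinearMap.mem_range]
    constructor
    · rintro ⟨x, rfl⟩
      refine ⟨⟨x, ?_⟩, rfl⟩
      have : x = A x - F x := by rw [hAx]; abel
      rw [this]
      exact sub_mem hy ⟨x, rfl⟩
    · rintro ⟨x, hx⟩
      exact ⟨x, congrArg Subtype.val hx⟩
  have d₁ := B.finrank_range_add_finrank_ker
  have d₂ := q.finrank_range_add_finrank_ker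
  rw [hkq, hq, finrank_top] at d₂
  rw [e.finrank_eq] at d₁
  refine ⟨e.finiteDimensional, .of_surjective q (LinearMap.range_eq_top.1 hq), ?_⟩
  unfold fredholmIndex
  lia

theorem hasFredholmIndex_zero_of_bijective {𝕜 V W : Type*} [Field 𝕜] [AddCommGroup V] [Module 𝕜 V]
    [AddCommGroup W] [Module 𝕜 W] {f : V →ₗ[𝕜] W} (hf : Function.Bijective f) :
    HasFredholmIndex f 0 := by
  have h₁ := LinearMap.ker_eq_bot.2 hf.1
  have h₂ := LinearMap.range_eq_top.2 hf.2
  have : Subsingleton (W ⧸ LinearMap.range f) := Submodule.Quotient.subsingleton_iff.2 h₂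
  refine ⟨by rw [h₁]; infer_instance, inferInstance, ?_⟩
  rw [fredholmIndex, h₁, finrank_bot, Module.finrank_zero_of_subsingleton, sub_self]

theorem finiteDimensional_ker_of_comp {𝕜 V W X : Type*} [Field 𝕜] [AddCommGroup V] [Module 𝕜 V]
    [AddCommGroup W] [Module 𝕜 W] [AddCommGroup X] [Module 𝕜 X]
    (g : W →ₗ[𝕜] X) (f : V →ₗ[𝕜] W) (h : FiniteDimensional 𝕜 (LinearMap.ker (g ∘ₗ f))) :
    FiniteDimensional 𝕜 (LinearMap.ker f) :=
  Submodule.finiteDimensional_of_le (LinearMap.ker_le_ker_comp f g)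

theorem finiteDimensional_coker_of_comp {𝕜 V W X : Type*} [Field 𝕜] [AddCommGroup V] [Module 𝕜 V]
    [AddCommGroup W] [Module 𝕜 W] [AddCommGroup X] [Module 𝕜 X]
    (g : W →ₗ[𝕜] X) (f : V →ₗ[𝕜] W)
    (h : FiniteDimensional 𝕜 (X ⧸ LinearMap.range (g ∘ₗ f))) :
    FiniteDimensional 𝕜 (X ⧸ LinearMap.range g) :=
  .of_surjective _ (Submodule.factor_surjective (LinearMap.range_comp_le_range f g))

/-- A compact operator into a Hilbert space is a norm limit of finite rank operators. -/
theorem IsCompactOperator.exists_finite_range_norm_sub_le {𝕜 E F : Type*} [RCLike 𝕜]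
    [NormedAddCommGroup E] [NormedSpace 𝕜 E] [NormedAddCommGroup F] [InnerProductSpace 𝕜 F]
    {K : E →L[𝕜] F} (hK : IsCompactOperator K) {ε : ℝ} (hε : 0 < ε) :
    ∃ G : E →L[𝕜] F, FiniteDimensional 𝕜 (LinearMap.range (G : E →ₗ[𝕜] F)) ∧
      ‖K - G‖ ≤ ε := by
  obtain ⟨C, hC, hKC⟩ := hK.image_closedBall_subset_compact (𝕜₁ := 𝕜) (f := (K : E →ₗ[𝕜] F)) 1
  obtain ⟨t, -, ht, htC⟩ := hC.finite_cover_balls hε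
  have : FiniteDimensional 𝕜 (Submodule.span 𝕜 t) := FiniteDimensional.span_of_finite 𝕜 ht
  set S := Submodule.span 𝕜 t
  refine ⟨S.starProjection ∘L K, ?_, ?_⟩
  · refine Submodule.finiteDimensional_of_le (S₂ := S) ?_
    rintro _ ⟨x, rfl⟩
    exact S.starProjection_apply_mem (K x)
  · refine ContinuousLinearMap.opNorm_le_of_unit_norm hε.le fun x hx ↦ ?_
    obtain ⟨y, hy, hxy⟩ := Set.mem_iUnion₂.1 (htC (hKC ⟨x, by simp [hx], rfl⟩))
    calc ‖(K - S.starProjection ∘L K) x‖ = ⨅ z : S, ‖K x - z‖ := S.starProjection_minimal (K x)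
      _ ≤ ‖K x - y‖ := ciInf_le ⟨0, by rintro _ ⟨z, rfl⟩; positivity⟩
          (⟨y, Submodule.subset_span hy⟩ : S)
      _ ≤ ε := by rw [← dist_eq_norm]; exact hxy.le

theorem IsCompactOperator.hasFredholmIndex_id_add {𝕜 E : Type*} [RCLike 𝕜]
    [NormedAddCommGroup E] [InnerProductSpace 𝕜 E] [CompleteSpace E]
    {K : E →L[𝕜] E} (hK : IsCompactOperator K) :
    HasFredholmIndex (LinearMap.id + (K : E →ₗ[𝕜] E)) 0 := by
  obtain ⟨G, hG, hKG⟩ := hK.exists_finite_range_norm_sub_le (𝕜 := 𝕜) (ε := 1 / 2) (by norm_num)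
  have hu : IsUnit (1 + (K - G)) := by
    have := isUnit_one_sub_of_norm_lt_one (x := G - K) (by rw [norm_sub_rev]; linarith)
    rwa [sub_eq_add_neg, neg_sub] at this
  obtain ⟨U, hU⟩ := hu
  have hUbij : Function.Bijective (U : E →L[𝕜] E) :=
    ContinuousLinearMap.isUnit_iff_bijective.1 U.isUnit
  let F : E →ₗ[𝕜] E := ((U⁻¹ : (E →L[𝕜] E)ˣ) : E →L[𝕜] E).toLinearMap ∘ₗ (G : E →ₗ[𝕜] E)
  have : FiniteDimensional 𝕜 (LinearMap.range F) := by
    rw [LinearMap.range_comp]; infer_instance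
  have h := (hasFredholmIndex_zero_of_bijective (f := (U : E →L[𝕜] E).toLinearMap) hUbij).comp
    (hasFredholmIndex_id_add_of_finite_range F)
  rw [add_zero] at h
  convert h using 1
  ext x
  have h₁ : (U : E →L[𝕜] E) (((U⁻¹ : (E →L[𝕜] E)ˣ) : E →L[𝕜] E) (G x)) = G x :=
    congrArg (fun T : E →L[𝕜] E ↦ T (G x)) U.mul_inv
  have h₂ : (U : E →L[𝕜] E) x = x + (K x - G x) := by rw [hU]; rfl
  simp only [F, LinearMap.comp_apply, LinearMap.add_apply, LinearMap.id_apply, map_add,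
    ContinuousLinearMap.coe_coe, h₁, h₂]
  abel

/-- An endomorphism of the range of a bounded idempotent that is a compact perturbation of the
identity has index zero. -/
theorem hasFredholmIndex_zero_of_compact_perturbation {𝕜 H : Type*} [RCLike 𝕜]
    [NormedAddCommGroup H] [InnerProductSpace 𝕜 H] [CompleteSpace H]
    {P : H →L[𝕜] H} (hP : P.comp P = P) {C : H →L[𝕜] H} (hC : IsCompactOperator C)
    (A : LinearMap.range (P : H →ₗ[𝕜] H) →ₗ[𝕜] LinearMap.range (P : H →ₗ[𝕜] H))
    (hA : ∀ x, (A x : H) = x + C x) : HasFredholmIndex A 0 := by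
  have hclosed : IsClosed (LinearMap.range (P : H →ₗ[𝕜] H) : Set H) :=
    ContinuousLinearMap.IsIdempotentElem.isClosed_range hP
  have : CompleteSpace (LinearMap.range (P : H →ₗ[𝕜] H)) := hclosed.completeSpace_coe
  have hmem (x : LinearMap.range (P : H →ₗ[𝕜] H)) : C x ∈ LinearMap.range (P : H →ₗ[𝕜] H) := by
    rw [← add_sub_cancel_left (x : H) (C x), ← hA]
    exact sub_mem (A x).2 x.2
  let K := (C ∘L (LinearMap.range (P : H →ₗ[𝕜] H)).subtypeL).codRestrict _ hmem
  have hK : IsCompactOperator K :=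
    (hC.comp_clm (LinearMap.range (P : H →ₗ[𝕜] H)).subtypeL).codRestrict hmem hclosed
  have hAK : A = LinearMap.id + K.toLinearMap := LinearMap.ext fun x ↦ Subtype.ext (hA x)
  rw [hAK]
  exact hK.hasFredholmIndex_id_add

theorem apply_coe_range_of_idempotent {𝕜 H : Type*} [RCLike 𝕜]
    [NormedAddCommGroup H] [NormedSpace 𝕜 H] {P : H →L[𝕜] H} (hP : P.comp P = P)
    (x : LinearMap.range (P : H →ₗ[𝕜] H)) : P x = x := by
  obtain ⟨_, y, rfl⟩ := x
  exact congrArg (fun T : H →L[𝕜] H ↦ T y) hP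

/-- The compression of `Q` to a map from the range of `P` to the range of `Q`. -/
def rangeCompression {𝕜 H : Type*} [RCLike 𝕜] [NormedAddCommGroup H] [NormedSpace 𝕜 H]
    (P Q : H →L[𝕜] H) : LinearMap.range (P : H →ₗ[𝕜] H) →ₗ[𝕜] LinearMap.range (Q : H →ₗ[𝕜] H) :=
  (Q : H →ₗ[𝕜] H).rangeRestrict.domRestrict _

theorem hasFredholmIndex_rangeCompression_comp {𝕜 H : Type*} [RCLike 𝕜]
    [NormedAddCommGroup H] [InnerProductSpace 𝕜 H] [CompleteSpace H]
    {P Q : H →L[𝕜] H} (hP : P.comp P = P) (hPQ : IsCompactOperator (⇑(P - Q))) :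
    HasFredholmIndex (rangeCompression Q P ∘ₗ rangeCompression P Q) 0 := by
  refine hasFredholmIndex_zero_of_compact_perturbation hP (C := -(P ∘L (P - Q)))
    (hPQ.clm_comp P).neg _ fun x ↦ ?_
  have hx := apply_coe_range_of_idempotent hP x
  change P (Q x) = x + -(P (P x - Q x))
  rw [map_sub, hx, hx]
  abel

theorem hasFredholmIndex_rangeCompression {𝕜 H : Type*} [RCLike 𝕜]
    [NormedAddCommGroup H] [InnerProductSpace 𝕜 H] [CompleteSpace H]
    {P Q : H →L[𝕜] H} (hP : P.comp P = P) (hQ : Q.comp Q = Q)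
    (hPQ : IsCompactOperator (⇑(P - Q))) :
    HasFredholmIndex (rangeCompression P Q) (fredholmIndex (rangeCompression P Q)) := by
  have hQP : IsCompactOperator (⇑(Q - P)) := by
    rw [← neg_sub P Q]
    exact hPQ.neg
  exact ⟨finiteDimensional_ker_of_comp _ _ (hasFredholmIndex_rangeCompression_comp hP hPQ).1,
    finiteDimensional_coker_of_comp _ _ (hasFredholmIndex_rangeCompression_comp hQ hQP).2, rfl⟩

theorem fredholmIndex_rangeCompression_add {𝕜 H : Type*} [RCLike 𝕜]
    [NormedAddCommGroup H] [InnerProductSpace 𝕜 H] [CompleteSpace H]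
    {P Q R : H →L[𝕜] H} (hP : P.comp P = P) (hQ : Q.comp Q = Q) (hR : R.comp R = R)
    (hPQ : IsCompactOperator (⇑(P - Q))) (hQR : IsCompactOperator (⇑(Q - R)))
    (hPR : IsCompactOperator (⇑(P - R))) :
    fredholmIndex (rangeCompression P R) =
      fredholmIndex (rangeCompression P Q) + fredholmIndex (rangeCompression Q R) := by
  have hRP : IsCompactOperator (⇑(R - P)) := by
    rw [← neg_sub P R]
    exact hPR.neg
  have hfPQ := hasFredholmIndex_rangeCompression hP hQ hPQ
  have hfQR := hasFredholmIndex_rangeCompression hQ hR hQR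
  have hfPR := hasFredholmIndex_rangeCompression hP hR hPR
  have hfRP := hasFredholmIndex_rangeCompression hR hP hRP
  have h₁ := (hfRP.comp hfPR).index_eq
  rw [(hasFredholmIndex_rangeCompression_comp hP hPR).index_eq] at h₁
  have h₂ := (hfRP.comp (hfQR.comp hfPQ)).index_eq
  have hcyc : HasFredholmIndex
      (rangeCompression R P ∘ₗ rangeCompression Q R ∘ₗ rangeCompression P Q) 0 := by
    refine hasFredholmIndex_zero_of_compact_perturbation hP
      (C := -((P ∘L R) ∘L (P - Q) + P ∘L (P - R)))
      ((hPQ.clm_comp (P ∘L R)).add (hPR.clm_comp P)).neg _ fun x ↦ ?_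
    have hx := apply_coe_range_of_idempotent hP x
    change P (R (Q x)) = x + -(P (R (P x - Q x)) + P (P x - R x))
    simp only [map_sub, hx]
    abel
  rw [hcyc.index_eq] at h₂
  linarith

theorem stmt_18 {H : Type*}
    [NormedAddCommGroup H] [InnerProductSpace ℂ H] [CompleteSpace H]
    (P₁ P₂ P₃ : H →L[ℂ] H)
    (hP₁sa : IsSelfAdjoint P₁) (hP₂sa : IsSelfAdjoint P₂) (hP₃sa : IsSelfAdjoint P₃)
    (hP₁ : P₁.comp P₁ = P₁) (hP₂ : P₂.comp P₂ = P₂) (hP₃ : P₃.comp P₃ = P₃)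
    (hcpt₁₂ : IsCompactOperator (⇑(P₁ - P₂)))
    (hcpt₂₃ : IsCompactOperator (⇑(P₂ - P₃)))
    (hcpt₁₃ : IsCompactOperator (⇑(P₁ - P₃)))
    (f₁₃ : (LinearMap.range (P₁ : H →ₗ[ℂ] H)) →ₗ[ℂ] (LinearMap.range (P₃ : H →ₗ[ℂ] H)))
    (hf₁₃ : ∀ x : LinearMap.range (P₁ : H →ₗ[ℂ] H), (f₁₃ x : H) = P₃ x)
    (f₁₂ : (LinearMap.range (P₁ : H →ₗ[ℂ] H)) →ₗ[ℂ] (LinearMap.range (P₂ : H →ₗ[ℂ] H)))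
    (hf₁₂ : ∀ x : LinearMap.range (P₁ : H →ₗ[ℂ] H), (f₁₂ x : H) = P₂ x)
    (f₂₃ : (LinearMap.range (P₂ : H →ₗ[ℂ] H)) →ₗ[ℂ] (LinearMap.range (P₃ : H →ₗ[ℂ] H)))
    (hf₂₃ : ∀ x : LinearMap.range (P₂ : H →ₗ[ℂ] H), (f₂₃ x : H) = P₃ x) :
    fredholmIndex f₁₃ = fredholmIndex f₁₂ + fredholmIndex f₂₃ := by
  have h₁₃ : f₁₃ = rangeCompression P₁ P₃ := LinearMap.ext fun x ↦ Subtype.ext (hf₁₃ x)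
  have h₁₂ : f₁₂ = rangeCompression P₁ P₂ := LinearMap.ext fun x ↦ Subtype.ext (hf₁₂ x)
  have h₂₃ : f₂₃ = rangeCompression P₂ P₃ := LinearMap.ext fun x ↦ Subtype.ext (hf₂₃ x)
  rw [h₁₃, h₁₂, h₂₃]
  exact fredholmIndex_rangeCompression_add hP₁ hP₂ hP₃ hcpt₁₂ hcpt₂₃ hcpt₁₃
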